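/- Let B = (β_n)_{n∈ℤ} be a Cantor real base and for each n ∈ ℤ let 𝐚_n = a_{n,1}a_{n,2}⋯ be a sequence of nonnegative integers not ending in a tail of zeros such that val_{S^n(B)}(0·𝐚_n) = 1 and a_{n,j+1}a_{n,j+2}⋯ ≤_lex 𝐚_{n-j} for all j ≥ 1. Then for every n ∈ ℤ, 𝐚_n is the lexicographically greatest sequence 𝐛 of nonnegative integers not ending in a tail of zeros with val_{S^n(B)}(0·𝐛) = 1, i.e., 𝐚_n = 𝐝_n. -/

import Mathlib

open Filter

/-- A Cantor real base: all entries `> 1`, with both one-sided partial products tending to `+∞`. -/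
def IsCantorBase (B : ℤ → ℝ) : Prop :=
  (∀ n, 1 < B n) ∧
  Tendsto (fun N : ℕ => ∏ i ∈ Finset.range N, B (i + 1)) atTop atTop ∧
  Tendsto (fun N : ℕ => ∏ i ∈ Finset.range N, B (-(i + 1))) atTop atTop

/-- `valS B n a = val_{S^n(B)}(0 · a)`, where `a j` is the `(j+1)`-st digit. -/
noncomputable def valS (B : ℤ → ℝ) (n : ℤ) (a : ℕ → ℕ) : ℝ :=
  ∑' j : ℕ, (a j : ℝ) / ∏ i ∈ Finset.range (j + 1), B (n - 1 - i)

/-- Strict lexicographic order on one-sided digit sequences. -/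
def lexLt (x y : ℕ → ℕ) : Prop := ∃ j, (∀ i < j, x i = y i) ∧ x j < y j

def lexLe (x y : ℕ → ℕ) : Prop := x = y ∨ lexLt x y

/-- The sequence ends in a tail of zeros. -/
def EvZero (x : ℕ → ℕ) : Prop := ∃ N, ∀ j ≥ N, x j = 0

/-- `t` is the greedy `S^n(B)`-expansion of `1`: it is lexicographically greatest among
sequences of nonnegative integers with value `1`. -/
def IsGreedyOne (B : ℤ → ℝ) (n : ℤ) (t : ℕ → ℕ) : Prop :=
  valS B n t = 1 ∧ ∀ b : ℕ → ℕ, valS B n b = 1 → lexLe b t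

/-- `d` is the quasi-greedy `S^n(B)`-expansion of `1`: it is lexicographically greatest among
sequences of nonnegative integers not ending in a tail of zeros with value `1`. -/
def IsQuasiGreedyOne (B : ℤ → ℝ) (n : ℤ) (d : ℕ → ℕ) : Prop :=
  ¬ EvZero d ∧ valS B n d = 1 ∧
    ∀ b : ℕ → ℕ, ¬ EvZero b → valS B n b = 1 → lexLe b d

/-- The product of the `k` entries of `B` just below index `n`. -/
noncomputable def baseProd (B : ℤ → ℝ) (n : ℤ) (k : ℕ) : ℝ :=
  ∏ i ∈ Finset.range k, B (n - 1 - i)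

/-- The summand of index `j` in `valS B n a`. -/
noncomputable def valTerm (B : ℤ → ℝ) (n : ℤ) (a : ℕ → ℕ) (j : ℕ) : ℝ :=
  (a j : ℝ) / baseProd B n (j + 1)

theorem baseProd_pos {B : ℤ → ℝ} (hB : ∀ n, 1 < B n) (n : ℤ) (k : ℕ) : 0 < baseProd B n k :=
  Finset.prod_pos fun _ _ => one_pos.trans (hB _)

theorem baseProd_add (B : ℤ → ℝ) (n : ℤ) (k l : ℕ) :
    baseProd B n (k + l) = baseProd B n k * baseProd B (n - k) l := by
  unfold baseProd
  rw [Finset.prod_range_add]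
  congr 1
  refine Finset.prod_congr rfl fun i _ => ?_
  congr 1
  push_cast
  ring

theorem valTerm_nonneg {B : ℤ → ℝ} (hB : ∀ n, 1 < B n) (n : ℤ) (a : ℕ → ℕ) (j : ℕ) :
    0 ≤ valTerm B n a j :=
  div_nonneg (Nat.cast_nonneg _) (baseProd_pos hB _ _).le

theorem valTerm_add (B : ℤ → ℝ) (n : ℤ) (a : ℕ → ℕ) (k i : ℕ) :
    valTerm B n a (i + k) = valTerm B (n - k) (fun m => a (m + k)) i / baseProd B n k := by
  unfold valTerm
  rw [show i + k + 1 = k + (i + 1) by ring, baseProd_add, div_div, mul_comm (baseProd B n k)]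

theorem summable_valTerm_of_valS_eq_one {B : ℤ → ℝ} {n : ℤ} {a : ℕ → ℕ} (h : valS B n a = 1) :
    Summable (valTerm B n a) := by
  by_contra hs
  have h0 : valS B n a = 0 := tsum_eq_zero_of_not_summable hs
  linarith

theorem summable_valTerm_shift {B : ℤ → ℝ} (hB : ∀ n, 1 < B n) {n : ℤ} {a : ℕ → ℕ}
    (h : Summable (valTerm B n a)) (k : ℕ) :
    Summable (valTerm B (n - k) fun m => a (m + k)) := by
  have h1 := ((summable_nat_add_iff k).2 h).mul_right (baseProd B n k)
  refine h1.congr fun i => ?_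
  rw [valTerm_add, div_mul_cancel₀ _ (baseProd_pos hB n k).ne']

theorem tsum_valTerm_add (B : ℤ → ℝ) (n : ℤ) (a : ℕ → ℕ) (k : ℕ) :
    ∑' i, valTerm B n a (i + k) = valS B (n - k) (fun m => a (m + k)) / baseProd B n k := by
  simp_rw [valTerm_add]
  exact tsum_div_const

theorem valS_eq_sum_add {B : ℤ → ℝ} {n : ℤ} {a : ℕ → ℕ}
    (h : Summable (valTerm B n a)) (k : ℕ) :
    valS B n a = ∑ i ∈ Finset.range k, valTerm B n a i +
      valS B (n - k) (fun m => a (m + k)) / baseProd B n k := by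
  rw [← tsum_valTerm_add]
  exact (h.sum_add_tsum_nat_add k).symm

theorem valS_nonneg {B : ℤ → ℝ} (hB : ∀ n, 1 < B n) (n : ℤ) (a : ℕ → ℕ) : 0 ≤ valS B n a :=
  tsum_nonneg fun j => valTerm_nonneg hB n a j

theorem valS_pos {B : ℤ → ℝ} (hB : ∀ n, 1 < B n) {n : ℤ} {a : ℕ → ℕ}
    (h : Summable (valTerm B n a)) {i : ℕ} (hi : a i ≠ 0) : 0 < valS B n a :=
  h.tsum_pos (valTerm_nonneg hB n a) i
    (div_pos (Nat.cast_pos.2 (Nat.pos_of_ne_zero hi)) (baseProd_pos hB _ _))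

/-- Comparison of the values of two sequences that first differ at index `k`. -/
theorem valS_sub_mul_le {B : ℤ → ℝ} (hB : ∀ n, 1 < B n) {n : ℤ} {x y : ℕ → ℕ}
    (hx : Summable (valTerm B n x)) (hy : Summable (valTerm B n y)) {k : ℕ}
    (heq : ∀ i < k, x i = y i) (hlt : x k < y k) :
    (valS B n x - valS B n y) * baseProd B n (k + 1) ≤
      valS B (n - (k + 1 : ℕ)) (fun m => x (m + (k + 1))) -
        valS B (n - (k + 1 : ℕ)) (fun m => y (m + (k + 1))) - 1 := by
  have hP := baseProd_pos hB n (k + 1)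
  have hsum : ∑ i ∈ Finset.range k, valTerm B n x i = ∑ i ∈ Finset.range k, valTerm B n y i :=
    Finset.sum_congr rfl fun i hi => by unfold valTerm; rw [heq i (Finset.mem_range.1 hi)]
  have hdig : (x k : ℝ) + 1 ≤ y k := by exact_mod_cast hlt
  rw [valS_eq_sum_add hx (k + 1), valS_eq_sum_add hy (k + 1), Finset.sum_range_succ,
    Finset.sum_range_succ, hsum]
  simp only [valTerm]
  field_simp
  linarith

theorem lexLt_of_not_lexLe {x y : ℕ → ℕ} (h : ¬ lexLe x y) : lexLt y x := by
  classical
  have hne : ∃ i, x i ≠ y i := by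
    by_contra! hall
    exact h (Or.inl (funext hall))
  have hmin : ∀ i < Nat.find hne, x i = y i := fun i hi => not_not.1 (Nat.find_min hne hi)
  refine ⟨Nat.find hne, fun i hi => (hmin i hi).symm, ?_⟩
  rcases lt_or_gt_of_ne (Nat.find_spec hne) with hlt | hgt
  · exact (h (Or.inr ⟨_, hmin, hlt⟩)).elim
  · exact hgt

/-- Every tail of `a n` has value at most `1` in the correspondingly shifted base. -/
theorem valS_shift_le_one {B : ℤ → ℝ} (hB : ∀ n, 1 < B n) {a : ℤ → ℕ → ℕ}
    (hval : ∀ n : ℤ, valS B n (a n) = 1)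
    (hcond : ∀ n : ℤ, ∀ j : ℕ, 1 ≤ j → lexLe (fun m => a n (m + j)) (a (n - j)))
    (n : ℤ) (j : ℕ) : valS B (n - j) (fun m => a n (m + j)) ≤ 1 := by
  by_contra! hj
  set c : ℕ → ℝ := fun i => (valS B (n - i) (fun m => a n (m + i)) - 1) / baseProd B n i with hc
  have hsum : ∀ m, Summable (valTerm B m (a m)) := fun m =>
    summable_valTerm_of_valS_eq_one (hval m)
  have hcpos : 0 < c j := div_pos (by linarith) (baseProd_pos hB n j)
  have step : ∀ i, 0 < c i → ∃ i' > i, c i ≤ c i' := by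
    intro i hi
    have hPi := baseProd_pos hB n i
    have hi1 : 1 < valS B (n - i) (fun m => a n (m + i)) := by
      have := (div_pos_iff_of_pos_right hPi).1 hi
      linarith
    have hlex : lexLe (fun m => a n (m + i)) (a (n - i)) := by
      rcases Nat.eq_zero_or_pos i with rfl | hpos
      · left; simp
      · exact hcond n i hpos
    rcases hlex with heq | ⟨k, heq, hlt⟩
    · rw [heq, hval] at hi1
      exact (lt_irrefl _ hi1).elim
    · have hle := valS_sub_mul_le hB (summable_valTerm_shift hB (hsum n) i) (hsum (n - i)) heq hlt
      have hnn := valS_nonneg hB (n - i - (k + 1 : ℕ)) (fun m => a (n - i) (m + (k + 1)))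
      refine ⟨i + (k + 1), by omega, ?_⟩
      have hidx : (n - (i + (k + 1) : ℕ) : ℤ) = n - i - (k + 1 : ℕ) := by push_cast; ring
      have hfun : (fun m => a n (m + (i + (k + 1)))) = fun m => a n (m + (k + 1) + i) := by
        funext m
        congr 1
        ring
      simp only [hc]
      rw [hidx, hfun, baseProd_add, div_le_div_iff₀ hPi (mul_pos hPi (baseProd_pos hB _ _))]
      rw [hval] at hle
      nlinarith [mul_le_mul_of_nonneg_right hle hPi.le, mul_nonneg hnn hPi.le]
  have hfar : ∀ N : ℕ, ∃ i ≥ N, c j ≤ c i := by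
    intro N
    induction N with
    | zero => exact ⟨j, Nat.zero_le _, le_rfl⟩
    | succ N ih =>
      obtain ⟨i, hi, hci⟩ := ih
      obtain ⟨i', hi', hci'⟩ := step i (hcpos.trans_le hci)
      exact ⟨i', by omega, hci.trans hci'⟩
  have htail := tendsto_sum_nat_add (valTerm B n (a n))
  obtain ⟨N, hN⟩ := eventually_atTop.1 (htail.eventually (gt_mem_nhds hcpos))
  obtain ⟨i, hi, hci⟩ := hfar N
  have hlt := hN i hi
  rw [tsum_valTerm_add] at hlt
  have hle : c i ≤ valS B (n - i) (fun m => a n (m + i)) / baseProd B n i :=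
    div_le_div_of_nonneg_right (by linarith) (baseProd_pos hB n i).le
  linarith

theorem stmt4 (B : ℤ → ℝ) (hB : IsCantorBase B) (a : ℤ → ℕ → ℕ)
    (hnz : ∀ n : ℤ, ¬ EvZero (a n))
    (hval : ∀ n : ℤ, valS B n (a n) = 1)
    (hcond : ∀ n : ℤ, ∀ j : ℕ, 1 ≤ j → lexLe (fun m => a n (m + j)) (a (n - j))) :
    ∀ n : ℤ, IsQuasiGreedyOne B n (a n) := by
  intro n
  refine ⟨hnz n, hval n, fun b hb hb1 => ?_⟩
  by_contra hlex
  obtain ⟨k, heq, hlt⟩ := lexLt_of_not_lexLe hlex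
  have hsb := summable_valTerm_of_valS_eq_one hb1
  have hle := valS_sub_mul_le hB.1 (summable_valTerm_of_valS_eq_one (hval n)) hsb heq hlt
  rw [hval, hb1, sub_self, zero_mul] at hle
  have hone := valS_shift_le_one hB.1 hval hcond n (k + 1)
  obtain ⟨i, hi, hbi⟩ : ∃ i ≥ k + 1, b i ≠ 0 := by
    by_contra! hall
    exact hb ⟨k + 1, hall⟩
  have hpos := valS_pos hB.1 (summable_valTerm_shift hB.1 hsb (k + 1)) (i := i - (k + 1))
    (by rwa [Nat.sub_add_cancel hi])
  linarith
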